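/- arXiv:1903.06087 — 2 statements merged into one kernel-verified Lean document; each statement's English description precedes it below -/
import Mathlib

section
/- Let ℓ ≥ 5 be an integer and let G be a finite simple graph with maximum degree Δ. If G contains no cycle on ℓ−1 vertices, no cycle on ℓ vertices, and no cycle on ℓ+1 vertices as a subgraph, then ω₂'(G) ≤ (ℓ − 2)(Δ − 1) + 2. -/
open SimpleGraph

/-- `G.ContainsSub H` means `G` contains a copy of `H` as a (not necessarily induced)
subgraph, i.e. there is an injective graph homomorphism from `H` to `G`. -/
def SimpleGraph.ContainsSub {V W : Type*} (G : SimpleGraph V) (H : SimpleGraph W) : Prop :=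
  ∃ f : W → V, Function.Injective f ∧ ∀ a b, H.Adj a b → G.Adj (f a) (f b)

/-- A strong clique of `G`: a set of edges of `G` any two distinct members of which
either share an endpoint or have endpoints joined by an edge of `G`. -/
def SimpleGraph.IsStrongClique {V : Type*} (G : SimpleGraph V) (F : Finset (Sym2 V)) : Prop :=
  (F : Set (Sym2 V)) ⊆ G.edgeSet ∧
    ∀ e ∈ F, ∀ f ∈ F, e ≠ f → ∃ x ∈ e, ∃ y ∈ f, x = y ∨ G.Adj x y

/-- The strong clique number `ω₂'(G)`: the largest cardinality of a strong clique. -/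
noncomputable def SimpleGraph.strongCliqueNumber {V : Type*} (G : SimpleGraph V) : ℕ :=
  sSup {n | ∃ F : Finset (Sym2 V), G.IsStrongClique F ∧ F.card = n}

namespace StrongCliqueAux

variable {V : Type*}

/-- `p 0, …, p k` is a path of `G`. -/
def IsP (G : SimpleGraph V) (p : ℕ → V) (k : ℕ) : Prop :=
  (∀ i j, i ≤ k → j ≤ k → p i = p j → i = j) ∧ ∀ i, i < k → G.Adj (p i) (p (i + 1))

/-- A path whose two end edges are in `F`. -/
def FPath (G : SimpleGraph V) (F : Finset (Sym2 V)) (p : ℕ → V) (k : ℕ) : Prop :=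
  1 ≤ k ∧ IsP G p k ∧ s(p 0, p 1) ∈ F ∧ s(p (k - 1), p k) ∈ F

/-- A path of length at least three whose first edge and last two edges are in `F`. -/
def FFPath (G : SimpleGraph V) (F : Finset (Sym2 V)) (p : ℕ → V) (k : ℕ) : Prop :=
  3 ≤ k ∧ FPath G F p k ∧ s(p (k - 2), p (k - 1)) ∈ F

def cons (x : V) (p : ℕ → V) : ℕ → V
  | 0 => x
  | i + 1 => p i

def snoc (p : ℕ → V) (k : ℕ) (x : V) : ℕ → V := fun i => if i ≤ k then p i else x

@[simp] theorem cons_zero (x : V) (p : ℕ → V) : cons x p 0 = x := rfl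
@[simp] theorem cons_succ (x : V) (p : ℕ → V) (i : ℕ) : cons x p (i + 1) = p i := rfl
@[simp] theorem cons_one (x : V) (p : ℕ → V) : cons x p 1 = p 0 := rfl
@[simp] theorem cons_two (x : V) (p : ℕ → V) : cons x p 2 = p 1 := rfl

theorem cons_pos (x : V) (p : ℕ → V) (i : ℕ) (h : 0 < i) : cons x p i = p (i - 1) := by
  cases i with
  | zero => omega
  | succ n => rfl

variable {G : SimpleGraph V} {F : Finset (Sym2 V)} {p : ℕ → V} {k : ℕ}

theorem IsP.cons (h : IsP G p k) {x : V} (hx : ∀ i, i ≤ k → p i ≠ x) (ha : G.Adj x (p 0)) :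
    IsP G (cons x p) (k + 1) := by
  refine ⟨?_, ?_⟩
  · rintro (_ | i) (_ | j) hi hj e
    · rfl
    · exact absurd e.symm (hx j (by omega))
    · exact absurd e (hx i (by omega))
    · have := h.1 i j (by omega) (by omega) e
      omega
  · rintro (_ | i) hi
    · exact ha
    · exact h.2 i (by omega)

theorem IsP.snoc (h : IsP G p k) {x : V} (hx : ∀ i, i ≤ k → p i ≠ x) (ha : G.Adj (p k) x) :
    IsP G (snoc p k x) (k + 1) := by
  refine ⟨?_, ?_⟩
  · intro i j hi hj e
    unfold StrongCliqueAux.snoc at e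
    split_ifs at e with h1 h2 h2
    · exact h.1 i j h1 h2 e
    · exact absurd e (hx i h1)
    · exact absurd e.symm (hx j h2)
    · omega
  · intro i hi
    unfold StrongCliqueAux.snoc
    rw [if_pos (by omega)]
    split_ifs with h1
    · exact h.2 i (by omega)
    · have : i = k := by omega
      subst this
      exact ha

theorem IsP.tail (h : IsP G p (k + 1)) : IsP G (fun i => p (i + 1)) k := by
  refine ⟨?_, ?_⟩
  · intro i j hi hj e
    have := h.1 (i + 1) (j + 1) (by omega) (by omega) e
    omega
  · intro i hi
    exact h.2 (i + 1) (by omega)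

theorem IsP.mono (h : IsP G p k) {m : ℕ} (hm : m ≤ k) : IsP G p m :=
  ⟨fun i j hi hj e => h.1 i j (by omega) (by omega) e, fun i hi => h.2 i (by omega)⟩

theorem IsP.rev (h : IsP G p k) : IsP G (fun i => p (k - i)) k := by
  refine ⟨?_, ?_⟩
  · intro i j hi hj e
    have := h.1 (k - i) (k - j) (by omega) (by omega) e
    omega
  · intro i hi
    have := h.2 (k - (i + 1)) (by omega)
    rw [show k - (i + 1) + 1 = k - i by omega] at this
    exact this.symm

theorem FPath.rev (h : FPath G F p k) : FPath G F (fun i => p (k - i)) k := by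
  obtain ⟨h1, h2, h3, h4⟩ := h
  refine ⟨h1, h2.rev, ?_, ?_⟩
  · simpa [Sym2.eq_swap] using h4
  · have : k - (k - 1) = 1 := by omega
    simpa [this, Sym2.eq_swap] using h3

theorem IsP.cycle (h : IsP G p k) (hk : 2 ≤ k) (ha : G.Adj (p 0) (p k)) :
    G.ContainsSub (cycleGraph (k + 1)) := by
  refine ⟨fun i => p i, ?_, ?_⟩
  · intro i j e
    exact Fin.ext (h.1 i j (by omega) (by omega) e)
  · have key : ∀ a b : Fin (k + 1), b - a = 1 → G.Adj (p a) (p b) := by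
      intro a b hab
      have hb : b = a + 1 := by rw [← hab]; abel
      by_cases hl : a = Fin.last k
      · subst hl
        subst hb
        simpa using ha.symm
      · have hv : (b : ℕ) = a + 1 := by
          rw [hb, Fin.val_add_one, if_neg hl]
        have hak : (a : ℕ) < k := Fin.val_lt_last hl
        rw [hv]
        exact h.2 a hak
    intro a b hab
    obtain ⟨n, rfl⟩ : ∃ n, k = n + 1 := ⟨k - 1, by omega⟩
    rw [cycleGraph_adj] at hab
    rcases hab with hab | hab
    · exact (key b a hab).symm
    · exact key a b hab

theorem no_FPath (hF : G.IsStrongClique F) (ℓ : ℕ) (hℓ : 5 ≤ ℓ)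
    (h1 : ¬ G.ContainsSub (cycleGraph (ℓ - 1)))
    (h2 : ¬ G.ContainsSub (cycleGraph ℓ))
    (h3 : ¬ G.ContainsSub (cycleGraph (ℓ + 1))) (p : ℕ → V) : ¬ FPath G F p ℓ := by
  obtain ⟨m, rfl⟩ : ∃ m, ℓ = m + 2 := ⟨ℓ - 2, by omega⟩
  rintro ⟨-, hp, ha, hb⟩
  simp only [show m + 2 - 1 = m + 1 by omega] at hb h1
  have hne : s(p 0, p 1) ≠ s(p (m + 1), p (m + 2)) := by
    intro e
    have : p 0 ∈ s(p (m + 1), p (m + 2)) := by rw [← e]; simp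
    rcases Sym2.mem_iff.1 this with e | e
    · have := hp.1 _ _ (by omega) (by omega) e
      omega
    · have := hp.1 _ _ (by omega) (by omega) e
      omega
  obtain ⟨x, hx, y, hy, hxy⟩ := hF.2 _ ha _ hb hne
  rcases Sym2.mem_iff.1 hx with rfl | rfl <;> rcases Sym2.mem_iff.1 hy with rfl | rfl <;>
    rcases hxy with e | e
  · have := hp.1 _ _ (by omega) (by omega) e
    omega
  · exact h2 ((hp.mono (m := m + 1) (by omega)).cycle (by omega) e)
  · have := hp.1 _ _ (by omega) (by omega) e
    omega
  · exact h3 (hp.cycle (by omega) e)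
  · have := hp.1 _ _ (by omega) (by omega) e
    omega
  · exact h1 ((hp.mono (m := m + 1) (by omega)).tail.cycle (by omega) e)
  · have := hp.1 _ _ (by omega) (by omega) e
    omega
  · exact h2 (hp.tail.cycle (by omega) e)

theorem FPath.cons1 (h : FPath G F p k) (hF : G.IsStrongClique F) {x : V}
    (hx : ∀ i, i ≤ k → p i ≠ x) (he : s(x, p 0) ∈ F) : FPath G F (cons x p) (k + 1) := by
  refine ⟨by omega, h.2.1.cons hx (hF.1 he), he, ?_⟩
  have := h.2.2.2
  have h1 := h.1
  rw [cons_pos _ _ _ (by omega), cons_pos _ _ _ (by omega)]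
  simpa using this

theorem FPath.cons2 (h : FPath G F p k) (hF : G.IsStrongClique F) {x y : V}
    (hx : ∀ i, i ≤ k → p i ≠ x) (hy : ∀ i, i ≤ k → p i ≠ y) (he : s(x, y) ∈ F)
    (ha : G.Adj y (p 0)) : FPath G F (cons x (cons y p)) (k + 2) := by
  have hxy : G.Adj x y := hF.1 he
  refine ⟨by omega, (h.2.1.cons hy ha).cons ?_ hxy, he, ?_⟩
  · rintro (_ | i) hi
    · exact hxy.ne'
    · exact hx i (by omega)
  · have := h.2.2.2
    have h1 := h.1
    obtain ⟨n, rfl⟩ : ∃ n, k = n + 1 := ⟨k - 1, by omega⟩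
    simpa using this

theorem FPath.cons3 (h : FPath G F p k) (hk : 2 ≤ k) (hF : G.IsStrongClique F) {x y : V}
    (hx : ∀ i, i ≤ k → p i ≠ x) (hy : ∀ i, i ≤ k → p i ≠ y) (he : s(x, y) ∈ F)
    (ha : G.Adj y (p 1)) :
    FPath G F (cons x (cons y (fun i => p (i + 1)))) (k + 1) := by
  have hxy : G.Adj x y := hF.1 he
  obtain ⟨n, rfl⟩ : ∃ n, k = n + 2 := ⟨k - 2, by omega⟩
  refine ⟨by omega, ((h.2.1.tail).cons ?_ ha).cons ?_ hxy, he, ?_⟩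
  · intro i hi
    exact hy (i + 1) (by omega)
  · rintro (_ | i) hi
    · exact hxy.ne'
    · exact hx (i + 1) (by omega)
  · have := h.2.2.2
    simpa using this

theorem FFPath.cons1 (h : FFPath G F p k) (hF : G.IsStrongClique F) {x : V}
    (hx : ∀ i, i ≤ k → p i ≠ x) (he : s(x, p 0) ∈ F) : FFPath G F (cons x p) (k + 1) := by
  obtain ⟨h3, h, h'⟩ := h
  refine ⟨by omega, h.cons1 hF hx he, ?_⟩
  obtain ⟨n, rfl⟩ : ∃ n, k = n + 3 := ⟨k - 3, by omega⟩
  simpa using h'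

theorem FFPath.cons2 (h : FFPath G F p k) (hF : G.IsStrongClique F) {x y : V}
    (hx : ∀ i, i ≤ k → p i ≠ x) (hy : ∀ i, i ≤ k → p i ≠ y) (he : s(x, y) ∈ F)
    (ha : G.Adj y (p 0)) : FFPath G F (cons x (cons y p)) (k + 2) := by
  obtain ⟨h3, h, h'⟩ := h
  refine ⟨by omega, h.cons2 hF hx hy he ha, ?_⟩
  obtain ⟨n, rfl⟩ : ∃ n, k = n + 3 := ⟨k - 3, by omega⟩
  simpa using h'

theorem FFPath.cons3 (h : FFPath G F p k) (hF : G.IsStrongClique F) {x y : V}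
    (hx : ∀ i, i ≤ k → p i ≠ x) (hy : ∀ i, i ≤ k → p i ≠ y) (he : s(x, y) ∈ F)
    (ha : G.Adj y (p 1)) :
    FFPath G F (cons x (cons y (fun i => p (i + 1)))) (k + 1) := by
  obtain ⟨h3, h, h'⟩ := h
  refine ⟨by omega, h.cons3 (by omega) hF hx hy he ha, ?_⟩
  obtain ⟨n, rfl⟩ : ∃ n, k = n + 3 := ⟨k - 3, by omega⟩
  simpa using h'

theorem FFPath.snoc1 (h : FFPath G F p k) (hF : G.IsStrongClique F) {x : V}
    (hx : ∀ i, i ≤ k → p i ≠ x) (he : s(p k, x) ∈ F) : FFPath G F (snoc p k x) (k + 1) := by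
  obtain ⟨h3, h, h'⟩ := h
  obtain ⟨n, rfl⟩ : ∃ n, k = n + 3 := ⟨k - 3, by omega⟩
  refine ⟨by omega, ⟨by omega, h.2.1.snoc hx (hF.1 he), ?_, ?_⟩, ?_⟩
  · simpa [snoc] using h.2.2.1
  · simpa [snoc] using he
  · simpa [snoc] using h.2.2.2

/-- Explicit paths of length four. -/
theorem FF4 (hF : G.IsStrongClique F) {a b c d e : V} (h1 : s(a, b) ∈ F) (h2 : G.Adj b c)
    (h3 : s(c, d) ∈ F) (h4 : s(d, e) ∈ F) (hac : a ≠ c) (had : a ≠ d) (hae : a ≠ e)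
    (hbd : b ≠ d) (hbe : b ≠ e) (hce : c ≠ e) : ∃ p, FFPath G F p 4 := by
  have a1 : G.Adj a b := hF.1 h1
  have a3 : G.Adj c d := hF.1 h3
  have a4 : G.Adj d e := hF.1 h4
  have q0 : IsP G (fun _ => e) 0 := ⟨fun i j hi hj _ => by omega, fun i hi => by omega⟩
  have q1 := q0.cons (x := d) (fun i _ => a4.ne') a4
  have q2 := q1.cons (x := c) (by
    rintro (_ | i) hi
    · exact a3.ne'
    · exact hce.symm) a3
  have q3 := q2.cons (x := b) (by
    rintro (_ | _ | i) hi
    · exact h2.ne'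
    · exact hbd.symm
    · exact hbe.symm) h2
  have q4 := q3.cons (x := a) (by
    rintro (_ | _ | _ | i) hi
    · exact a1.ne'
    · exact hac.symm
    · exact had.symm
    · exact hae.symm) a1
  exact ⟨_, by omega, ⟨by omega, q4, h1, h4⟩, h3⟩

/-- Classification of the edges of `F` avoiding the interior of an `F`-path. -/
theorem classify (hF : G.IsStrongClique F) (h : FPath G F p k) {e : Sym2 V} (he : e ∈ F)
    (hi : ∀ i, 1 ≤ i → i < k → p i ∉ e) :
    e = s(p 0, p k) ∨ (∃ w, (∀ i, i ≤ k → p i ≠ w) ∧ s(w, p 0) = e) ∨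
      (∃ w, (∀ i, i ≤ k → p i ≠ w) ∧ s(p k, w) = e) ∨
      ∃ x y, (∀ i, i ≤ k → p i ≠ x) ∧ (∀ i, i ≤ k → p i ≠ y) ∧ s(x, y) = e ∧
        (G.Adj y (p 0) ∨ G.Adj y (p 1)) := by
  have h1 := h.1
  by_cases h0 : p 0 ∈ e
  · obtain ⟨w, rfl⟩ := Sym2.mem_iff_exists.1 h0
    by_cases hw : w = p k
    · left; rw [hw]
    · right; left
      refine ⟨w, ?_, Sym2.eq_swap⟩
      rintro i hik rfl
      have ha : G.Adj (p 0) (p i) := hF.1 he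
      have hi0 : i ≠ 0 := by rintro rfl; exact ha.ne rfl
      have hik' : i ≠ k := by rintro rfl; exact hw rfl
      exact hi i (by omega) (by omega) (by simp)
  · by_cases hk : p k ∈ e
    · obtain ⟨w, rfl⟩ := Sym2.mem_iff_exists.1 hk
      right; right; left
      refine ⟨w, ?_, rfl⟩
      rintro i hik rfl
      have ha : G.Adj (p k) (p i) := hF.1 he
      have hi0 : i ≠ 0 := by rintro rfl; exact h0 (by simp)
      have hik' : i ≠ k := by rintro rfl; exact ha.ne rfl
      exact hi i (by omega) (by omega) (by simp)
    · right; right; right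
      have hall : ∀ i, i ≤ k → p i ∉ e := by
        intro i hik
        rcases Nat.eq_zero_or_pos i with rfl | hpos
        · exact h0
        · rcases Nat.eq_or_lt_of_le hik with rfl | hlt
          · exact hk
          · exact hi i hpos hlt
      have hne : e ≠ s(p 0, p 1) := by
        rintro rfl
        exact h0 (by simp)
      obtain ⟨y, hy, z, hz, hyz⟩ := hF.2 e he _ h.2.2.1 hne
      obtain ⟨x, rfl⟩ := Sym2.mem_iff_exists.1 hy
      refine ⟨x, y, ?_, ?_, Sym2.eq_swap, ?_⟩
      · rintro i hik rfl
        exact hall i hik (by simp)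
      · rintro i hik rfl
        exact hall i hik (by simp)
      · rcases Sym2.mem_iff.1 hz with rfl | rfl
        · rcases hyz with rfl | hyz
          · exact absurd hy h0
          · exact Or.inl hyz
        · rcases hyz with rfl | hyz
          · exact absurd hy (hall 1 h1)
          · exact Or.inr hyz

theorem exists_max (P : ℕ → Prop) (n : ℕ) (h : ∃ k, k ≤ n ∧ P k) :
    ∃ k, k ≤ n ∧ P k ∧ ∀ j, k < j → j ≤ n → ¬ P j := by
  classical
  obtain ⟨k, hk, hP⟩ := h
  exact ⟨Nat.findGreatest P n, Nat.findGreatest_le n, Nat.findGreatest_spec hk hP,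
    fun j hj hjn => Nat.findGreatest_is_greatest hj hjn⟩

theorem cover (h : IsP G p k) {e : Sym2 V} (hi : ∃ i, 1 ≤ i ∧ i < k ∧ p i ∈ e) :
    p 1 ∈ e ∨ ∃ i, 2 ≤ i ∧ i < k ∧ p i ∈ e ∧ e ≠ s(p (i - 1), p i) := by
  classical
  obtain ⟨h1, h2, h3⟩ := Nat.find_spec hi
  have hmin := fun j => Nat.find_min (m := j) hi
  set i := Nat.find hi
  rcases Nat.eq_or_lt_of_le h1 with h | h
  · left; rw [h]; exact h3
  · right
    refine ⟨i, h, h2, h3, ?_⟩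
    intro he
    refine hmin (i - 1) (by omega) ⟨by omega, by omega, ?_⟩
    rw [he]
    simp

theorem count [Fintype V] [DecidableEq V] [DecidableRel G.Adj] (hF : G.IsStrongClique F)
    (h : IsP G p k) (hk : 1 ≤ k) (ℓ : ℕ) (hℓ : k + 1 ≤ ℓ) (hℓ5 : 5 ≤ ℓ) (A : Finset (Sym2 V))
    (hA : A.card ≤ G.maxDegree + 1)
    (hc : ∀ e ∈ F, e ∈ A ∨ ∃ i, 2 ≤ i ∧ i < k ∧ p i ∈ e ∧ e ≠ s(p (i - 1), p i)) :
    F.card ≤ (ℓ - 2) * (G.maxDegree - 1) + 2 := by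
  have hd : 1 ≤ G.maxDegree := by
    have h1 : 0 < G.degree (p 0) := by
      rw [G.degree_pos_iff_exists_adj]
      exact ⟨_, h.2 0 (by omega)⟩
    exact h1.trans_le (G.degree_le_maxDegree _)
  have hsub : F ⊆ A ∪ (Finset.Ico 2 k).biUnion
      (fun i => (G.incidenceFinset (p i)).erase s(p (i - 1), p i)) := by
    intro e he
    rw [Finset.mem_union]
    rcases hc e he with h' | ⟨i, hi2, hik, hm, hne⟩
    · exact Or.inl h'
    · right
      rw [Finset.mem_biUnion]
      refine ⟨i, Finset.mem_Ico.2 ⟨hi2, hik⟩, Finset.mem_erase.2 ⟨hne, ?_⟩⟩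
      rw [mem_incidenceFinset]
      exact ⟨hF.1 he, hm⟩
  have hb : ((Finset.Ico 2 k).biUnion
      (fun i => (G.incidenceFinset (p i)).erase s(p (i - 1), p i))).card
      ≤ (Finset.Ico 2 k).card * (G.maxDegree - 1) := by
    apply Finset.card_biUnion_le_card_mul
    intro i hi
    rw [Finset.mem_Ico] at hi
    rw [Finset.card_erase_of_mem, card_incidenceFinset_eq_degree]
    · have := G.degree_le_maxDegree (p i)
      omega
    · rw [mem_incidenceFinset]
      refine ⟨?_, by simp⟩
      have := h.2 (i - 1) (by omega)
      rw [show i - 1 + 1 = i by omega] at this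
      exact this
  have h1 := (Finset.card_le_card hsub).trans (Finset.card_union_le _ _)
  rw [Nat.card_Ico] at hb
  have h2 : (k - 2) * (G.maxDegree - 1) ≤ (ℓ - 3) * (G.maxDegree - 1) :=
    Nat.mul_le_mul_right _ (by omega)
  have h3 : (ℓ - 2) * (G.maxDegree - 1) = (ℓ - 3) * (G.maxDegree - 1) + (G.maxDegree - 1) := by
    rw [show ℓ - 2 = (ℓ - 3) + 1 by omega]
    ring
  omega

/-- The count when all edges of `F` meet the interior, except possibly the edge joining the ends. -/
theorem count' [Fintype V] [DecidableEq V] [DecidableRel G.Adj] (hF : G.IsStrongClique F)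
    (h : IsP G p k) (hk : 1 ≤ k) (ℓ : ℕ) (hℓ : k + 1 ≤ ℓ) (hℓ5 : 5 ≤ ℓ)
    (hc : ∀ e ∈ F, (∀ i, 1 ≤ i → i < k → p i ∉ e) → e = s(p 0, p k)) :
    F.card ≤ (ℓ - 2) * (G.maxDegree - 1) + 2 := by
  refine count hF h hk ℓ hℓ hℓ5 (insert s(p 0, p k) (G.incidenceFinset (p 1))) ?_ ?_
  · refine (Finset.card_insert_le _ _).trans ?_
    rw [card_incidenceFinset_eq_degree]
    have := G.degree_le_maxDegree (p 1)
    omega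
  · intro e he
    by_cases hi : ∃ i, 1 ≤ i ∧ i < k ∧ p i ∈ e
    · rcases cover h hi with h' | h'
      · left
        rw [Finset.mem_insert, mem_incidenceFinset]
        exact Or.inr ⟨hF.1 he, h'⟩
      · exact Or.inr h'
    · left
      rw [Finset.mem_insert]
      left
      apply hc e he
      intro i h1 h2 h3
      exact hi ⟨i, h1, h2, h3⟩

theorem caseA [Fintype V] [DecidableEq V] [DecidableRel G.Adj] (hF : G.IsStrongClique F)
    (ℓ : ℕ) (hℓ : 5 ≤ ℓ) (hno : ∀ p, ¬ FPath G F p ℓ)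
    (hex : ∃ k, k ≤ ℓ - 1 ∧ ∃ p, FFPath G F p k) :
    F.card ≤ (ℓ - 2) * (G.maxDegree - 1) + 2 := by
  obtain ⟨k, hk, ⟨p, hp⟩, hmax⟩ := exists_max _ _ hex
  have hk3 := hp.1
  have hno1 : ∀ q, ¬ FFPath G F q (k + 1) := by
    intro q hq
    by_cases hkl : k + 1 = ℓ
    · rw [hkl] at hq
      exact hno q hq.2.1
    · exact hmax (k + 1) (by omega) (by omega) ⟨q, hq⟩
  refine count' hF hp.2.1.2.1 (by omega) ℓ (by omega) hℓ ?_
  intro e he hi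
  rcases classify hF hp.2.1 he hi with h | ⟨w, hw, rfl⟩ | ⟨w, hw, rfl⟩ |
    ⟨x, y, hx, hy, rfl, ha | ha⟩
  · exact h
  · exact absurd (hp.cons1 hF hw he) (hno1 _)
  · exact absurd (hp.snoc1 hF hw he) (hno1 _)
  · exfalso
    have h2 := hp.cons2 hF hx hy he ha
    by_cases h' : k + 2 ≤ ℓ - 1
    · exact hmax _ (by omega) h' ⟨_, h2⟩
    · by_cases h'' : k + 2 = ℓ
      · rw [h''] at h2
        exact hno _ h2.2.1
      · -- k + 1 = ℓ : drop the last vertex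
        have hk1 : k + 1 = ℓ := by omega
        have h5 : FPath G F p (k - 1) :=
          ⟨by omega, hp.2.1.2.1.mono (by omega), hp.2.1.2.2.1, hp.2.2⟩
        have h6 := h5.cons2 hF (fun i hi => hx i (by omega)) (fun i hi => hy i (by omega)) he ha
        rw [show k - 1 + 2 = ℓ by omega] at h6
        exact hno _ h6
  · exact absurd (hp.cons3 hF hx hy he ha) (hno1 _)

theorem caseB [Fintype V] [DecidableEq V] [DecidableRel G.Adj] (hF : G.IsStrongClique F)
    (ℓ : ℕ) (hℓ : 5 ≤ ℓ) (hno : ∀ p, ¬ FPath G F p ℓ)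
    (h2 : ¬ G.ContainsSub (cycleGraph ℓ)) (h3 : ¬ G.ContainsSub (cycleGraph (ℓ + 1)))
    (hFF : ∀ p, ¬ FFPath G F p 4) (hne : F.Nonempty) :
    F.card ≤ (ℓ - 2) * (G.maxDegree - 1) + 2 := by
  have hex : ∃ k, k ≤ ℓ - 1 ∧ ∃ p, FPath G F p k := by
    obtain ⟨e, he⟩ := hne
    induction e with
    | _ x y =>
      refine ⟨1, by omega, cons x (fun _ => y), le_rfl, ?_, he, he⟩
      have ha : G.Adj x y := hF.1 he
      have q0 : IsP G (fun _ => y) 0 := ⟨fun i j hi hj _ => by omega, fun i hi => by omega⟩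
      exact q0.cons (fun _ _ => ha.ne') ha
  obtain ⟨k, hk, ⟨p, hp⟩, hmax⟩ := exists_max _ _ hex
  have hk1 := hp.1
  have hno1 : ∀ q, ¬ FPath G F q (k + 1) := by
    intro q hq
    by_cases hkl : k + 1 = ℓ
    · rw [hkl] at hq
      exact hno q hq
    · exact hmax (k + 1) (by omega) (by omega) ⟨q, hq⟩
  have hsnoc : ∀ w, (∀ i, i ≤ k → p i ≠ w) → s(p k, w) ∈ F → False := by
    intro w hw he
    refine hno1 _ (hp.rev.cons1 hF (x := w) (fun i hi => hw _ (by omega)) ?_)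
    simpa [Sym2.eq_swap] using he
  by_cases hkl : k + 1 = ℓ
  swap
  · -- short maximal path
    refine count' hF hp.2.1 hk1 ℓ (by omega) hℓ ?_
    intro e he hi
    rcases classify hF hp he hi with h | ⟨w, hw, rfl⟩ | ⟨w, hw, rfl⟩ |
      ⟨x, y, hx, hy, rfl, ha | ha⟩
    · exact h
    · exact absurd (hp.cons1 hF hw he) (hno1 _)
    · exact absurd he (hsnoc w hw)
    · exfalso
      have h2 := hp.cons2 hF hx hy he ha
      by_cases h' : k + 2 = ℓ
      · rw [h'] at h2
        exact hno _ h2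
      · exact hmax _ (by omega) (by omega) ⟨_, h2⟩
    · exfalso
      by_cases hk2 : 2 ≤ k
      · exact hno1 _ (hp.cons3 hk2 hF hx hy he ha)
      · have hk1' : k = 1 := by omega
        subst hk1'
        have h2 := hp.rev.cons2 hF (fun i hi => hx _ (by omega)) (fun i hi => hy _ (by omega))
          he (by simpa using ha)
        exact hmax _ (by omega) (by omega) ⟨_, h2⟩
  · -- `k + 1 = ℓ`
    have hk4 : 4 ≤ k := by omega
    haveI : DecidablePred (fun e : Sym2 V => ∀ i, 1 ≤ i → i < k → p i ∉ e) :=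
      Classical.decPred _
    set D : Finset (Sym2 V) := F.filter (fun e => ∀ i, 1 ≤ i → i < k → p i ∉ e) with hD
    have hDF : ∀ e ∈ D, e ∈ F := fun e he => (Finset.mem_filter.1 he).1
    have hDspec : ∀ e ∈ D, ∃ x y, (∀ i, i ≤ k → p i ≠ x) ∧ (∀ i, i ≤ k → p i ≠ y) ∧
        s(x, y) = e ∧ G.Adj y (p 0) := by
      intro e he'
      obtain ⟨he, hi⟩ := Finset.mem_filter.1 he'
      rcases classify hF hp he hi with rfl | ⟨w, hw, rfl⟩ | ⟨w, hw, rfl⟩ |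
        ⟨x, y, hx, hy, rfl, ha | ha⟩
      · exfalso
        have := hp.2.1.cycle (by omega) (hF.1 he)
        rw [hkl] at this
        exact h2 this
      · exact absurd (hp.cons1 hF hw he) (hno1 _)
      · exact absurd he (hsnoc w hw)
      · exact ⟨x, y, hx, hy, rfl, ha⟩
      · exact absurd (hp.cons3 (by omega) hF hx hy he ha) (hno1 _)
    have hDspec' : ∀ e ∈ D, ∃ x y, (∀ i, i ≤ k → p i ≠ x) ∧ (∀ i, i ≤ k → p i ≠ y) ∧
        s(x, y) = e ∧ G.Adj y (p 0) ∧ G.Adj x (p k) := by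
      intro e he'
      obtain ⟨he, hi⟩ := Finset.mem_filter.1 he'
      obtain ⟨x, y, hx, hy, rfl, ha⟩ := hDspec e he'
      refine ⟨x, y, hx, hy, rfl, ha, ?_⟩
      have hne : s(x, y) ≠ s(p (k - 1), p k) := by
        intro e
        have : x ∈ s(p (k - 1), p k) := by rw [← e]; simp
        rcases Sym2.mem_iff.1 this with e | e
        · exact hx _ (by omega) e.symm
        · exact hx _ (by omega) e.symm
      obtain ⟨u, hu, v, hv, huv⟩ := hF.2 _ he _ hp.2.2.2 hne
      have hu' : ∀ i, i ≤ k → p i ≠ u := by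
        rcases Sym2.mem_iff.1 hu with rfl | rfl
        · exact hx
        · exact hy
      rcases Sym2.mem_iff.1 hv with rfl | rfl
      · exfalso
        rcases huv with huv | huv
        · exact hu' _ (by omega) huv.symm
        obtain ⟨z, hz⟩ := Sym2.mem_iff_exists.1 hu
        have hz' : ∀ i, i ≤ k → p i ≠ z := by
          have : z ∈ s(x, y) := by rw [hz]; simp
          rcases Sym2.mem_iff.1 this with rfl | rfl
          · exact hx
          · exact hy
        refine hno1 _ (hp.rev.cons3 (by omega) hF (x := z) (y := u) (fun i hi => hz' _ (by omega))
          (fun i hi => hu' _ (by omega)) ?_ huv)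
        rw [Sym2.eq_swap, ← hz]
        exact he
      · rcases huv with huv | huv
        · exact absurd huv.symm (hu' _ le_rfl)
        rcases Sym2.mem_iff.1 hu with rfl | rfl
        · exact huv
        · exfalso
          have := (hp.2.1.cons hy ha).cycle (by omega) huv
          rw [hkl] at this
          exact h3 this
    have hDdisj : ∀ e ∈ D, ∀ f ∈ D, ∀ z, z ∈ e → z ∈ f → e = f := by
      intro e he f hf z hze hzf
      by_contra hef
      obtain ⟨x, y, hx, hy, rfl, ha, hb⟩ := hDspec' e he
      obtain ⟨w, rfl⟩ := Sym2.mem_iff_exists.1 hzf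
      have hw : ∀ i, i ≤ k → p i ≠ w := by
        obtain ⟨x', y', hx', hy', hs, -⟩ := hDspec _ hf
        have : w ∈ s(x', y') := by rw [hs]; simp
        rcases Sym2.mem_iff.1 this with rfl | rfl
        · exact hx'
        · exact hy'
      have hxy : G.Adj x y := hF.1 (hDF _ he)
      have hzw : G.Adj z w := hF.1 (hDF _ hf)
      rcases Sym2.mem_iff.1 hze with rfl | rfl
      · -- path p 1, p 0, y, z, w
        have hyw : y ≠ w := by rintro rfl; exact hef rfl
        obtain ⟨q, hq⟩ := FF4 hF (a := p 1) (b := p 0) (c := y) (d := z) (e := w)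
          (by rw [Sym2.eq_swap]; exact hp.2.2.1) ha.symm (by rw [Sym2.eq_swap]; exact hDF _ he)
          (hDF _ hf) (hy _ (by omega)) (hx _ (by omega)) (hw _ (by omega)) (hx _ (by omega))
          (hw _ (by omega)) hyw
        exact hFF q hq
      · have hxw : x ≠ w := by rintro rfl; exact hef Sym2.eq_swap
        obtain ⟨q, hq⟩ := FF4 hF (a := p (k - 1)) (b := p k) (c := x) (d := z) (e := w)
          hp.2.2.2 hb.symm (hDF _ he)
          (hDF _ hf) (hx _ (by omega)) (hy _ (by omega)) (hw _ (by omega)) (hy _ (by omega))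
          (hw _ (by omega)) hxw
        exact hFF q hq
    rcases D.eq_empty_or_nonempty with hD0 | ⟨e₀, he₀⟩
    · refine count' hF hp.2.1 hk1 ℓ (by omega) hℓ ?_
      intro e he hi
      exfalso
      have : e ∈ D := Finset.mem_filter.2 ⟨he, hi⟩
      rw [hD0] at this
      simp at this
    · have hDcard : D.card ≤ G.maxDegree := by
        have : ∃ g : Sym2 V → V, ∀ e ∈ D, g e ∈ e ∧ G.Adj (p 0) (g e) := by
          have : ∀ e, ∃ v, e ∈ D → v ∈ e ∧ G.Adj (p 0) v := by
            intro e
            by_cases he : e ∈ D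
            · obtain ⟨x, y, -, -, rfl, ha⟩ := hDspec e he
              exact ⟨y, fun _ => ⟨by simp, ha.symm⟩⟩
            · exact ⟨p 0, fun h => absurd h he⟩
          choose g hg using this
          exact ⟨g, hg⟩
        obtain ⟨g, hg⟩ := this
        refine le_trans ?_ (G.degree_le_maxDegree (p 0))
        rw [← card_neighborFinset_eq_degree]
        refine Finset.card_le_card_of_injOn g ?_ ?_
        · intro e he
          simpa using (hg e he).2
        · intro e he f hf hef
          exact hDdisj e he f hf (g e) (hg e he).1 (by rw [hef]; exact (hg f hf).1)
      refine count hF hp.2.1 hk1 ℓ (by omega) hℓ (insert s(p 0, p 1) D) ?_ ?_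
      · exact (Finset.card_insert_le _ _).trans (by omega)
      · intro e he
        by_cases hi : ∃ i, 1 ≤ i ∧ i < k ∧ p i ∈ e
        · rcases cover hp.2.1 hi with h' | h'
          · left
            rw [Finset.mem_insert]
            left
            by_contra hne'
            obtain ⟨w, rfl⟩ := Sym2.mem_iff_exists.1 h'
            obtain ⟨x, y, hx, hy, rfl, ha⟩ := hDspec e₀ he₀
            have hxyF := hDF _ he₀
            have h1w : G.Adj (p 1) w := hF.1 he
            have h0w : p 0 ≠ w := by
              rintro rfl
              exact hne' Sym2.eq_swap
            have hxw : x ≠ w := by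
              rintro rfl
              refine hno1 _ (hp.cons3 (x := y) (y := x) (by omega) hF hy hx ?_ h1w.symm)
              rw [Sym2.eq_swap]; exact hxyF
            have hyw : y ≠ w := by
              rintro rfl
              exact hno1 _ (hp.cons3 (x := x) (y := y) (by omega) hF hx hy hxyF h1w.symm)
            obtain ⟨q, hq⟩ := FF4 hF (a := x) (b := y) (c := p 0) (d := p 1) (e := w)
              hxyF ha hp.2.2.1 he (hx _ (by omega)).symm (hx _ (by omega)).symm hxw
              (hy _ (by omega)).symm hyw h0w
            exact hFF q hq
          · exact Or.inr h'
        · left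
          refine Finset.mem_insert_of_mem (Finset.mem_filter.2 ⟨he, ?_⟩)
          intro i h1 h2 h3
          exact hi ⟨i, h1, h2, h3⟩

end StrongCliqueAux

/-- Theorem 4.1(2): if `ℓ ≥ 5` and `G` is `{C_{ℓ-1}, C_ℓ, C_{ℓ+1}}`-free with maximum
degree `Δ`, then `ω₂'(G) ≤ (ℓ - 2)(Δ - 1) + 2`. -/
theorem strongCliqueNumber_le_of_threeCycleLengthsFree {V : Type*} [Fintype V] [DecidableEq V]
    (ℓ : ℕ) (hℓ : 5 ≤ ℓ) (G : SimpleGraph V) [DecidableRel G.Adj]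
    (Δ : ℕ) (hΔ : G.maxDegree = Δ)
    (h1 : ¬ G.ContainsSub (cycleGraph (ℓ - 1)))
    (h2 : ¬ G.ContainsSub (cycleGraph ℓ))
    (h3 : ¬ G.ContainsSub (cycleGraph (ℓ + 1))) :
    G.strongCliqueNumber ≤ (ℓ - 2) * (Δ - 1) + 2 := by
  subst hΔ
  unfold SimpleGraph.strongCliqueNumber
  apply csSup_le'
  rintro n ⟨F, hF, rfl⟩
  have hno := StrongCliqueAux.no_FPath hF ℓ hℓ h1 h2 h3
  rcases F.eq_empty_or_nonempty with rfl | hne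
  · simp
  by_cases hex : ∃ k, k ≤ ℓ - 1 ∧ ∃ p, StrongCliqueAux.FFPath G F p k
  · exact StrongCliqueAux.caseA hF ℓ hℓ hno hex
  · exact StrongCliqueAux.caseB hF ℓ hℓ hno h2 h3
      (fun p hp => hex ⟨4, by omega, p, hp⟩) hne
end

section
/- Let k ≥ 3 be an integer and let G be a finite simple graph with maximum degree Δ ≥ 3. If G is C_{2k}-free (contains no cycle on 2k vertices as a subgraph), then ω₂'(G) ≤ (5k² + 14k)(Δ − 1). -/
open SimpleGraph

open Finset in
/-- Passing to a bipartite subrelation of large minimum degree. -/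
theorem exists_minDegree_sub {V : Type*} [DecidableEq V] (R : V → V → Prop)
    [DecidableRel R] (s : ℕ) : ∀ (N : ℕ) (X Y : Finset V), X.card + Y.card = N →
    s * N < ∑ x ∈ X, (Y.filter (fun y => R x y)).card →
    ∃ X' ⊆ X, ∃ Y' ⊆ Y, X'.Nonempty ∧
      (∀ x ∈ X', s < (Y'.filter (fun y => R x y)).card) ∧
      (∀ y ∈ Y', s < (X'.filter (fun x => R x y)).card) := by
  intro N
  induction N with
  | zero =>
    intro X Y h1 h2
    have : X = ∅ := by
      rw [← Finset.card_eq_zero]; omega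
    subst this
    simp at h2
  | succ N ih =>
    intro X Y h1 h2
    by_cases hx : ∃ x ∈ X, (Y.filter (fun y => R x y)).card ≤ s
    · obtain ⟨x, hxX, hxs⟩ := hx
      have hc := Finset.card_erase_add_one hxX
      have hs := Finset.add_sum_erase X (fun x => (Y.filter (fun y => R x y)).card) hxX
      have := ih (X.erase x) Y (by omega) (by rw [Nat.mul_succ] at h2; omega)
      obtain ⟨X', hX', Y', hY', h⟩ := this
      exact ⟨X', hX'.trans (Finset.erase_subset _ _), Y', hY', h⟩
    by_cases hy : ∃ y ∈ Y, (X.filter (fun x => R x y)).card ≤ s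
    · obtain ⟨y, hyY, hys⟩ := hy
      have hc := Finset.card_erase_add_one hyY
      have e1 : ∀ Z : Finset V, ∑ x ∈ X, (Z.filter (fun y => R x y)).card
          = ∑ y ∈ Z, (X.filter (fun x => R x y)).card := fun Z =>
        Finset.sum_card_bipartiteAbove_eq_sum_card_bipartiteBelow R
      have hs := Finset.add_sum_erase Y (fun y => (X.filter (fun x => R x y)).card) hyY
      have := ih X (Y.erase y) (by omega) (by
        rw [e1] at h2 ⊢
        rw [Nat.mul_succ] at h2; omega)
      obtain ⟨X', hX', Y', hY', h⟩ := this
      exact ⟨X', hX', Y', hY'.trans (Finset.erase_subset _ _), h⟩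
    push Not at hx hy
    refine ⟨X, subset_rfl, Y, subset_rfl, ?_, hx, hy⟩
    rw [Finset.nonempty_iff_ne_empty]
    rintro rfl
    simp at h2

/-- Greedy construction of an alternating path starting at `v`. -/
theorem exists_greedy_path {V : Type*} [DecidableEq V] (G : SimpleGraph V)
    [DecidableRel G.Adj] (s : ℕ) (v : V) (X Y : Finset V) (hX : X.Nonempty)
    (hvX : v ∉ X) (hvY : v ∉ Y) (hadj : ∀ x ∈ X, G.Adj v x)
    (h1 : ∀ x ∈ X, s < (Y.filter (fun y => G.Adj x y)).card)
    (h2 : ∀ y ∈ Y, s < (X.filter (fun x => G.Adj x y)).card) :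
    ∀ j : ℕ, j ≤ s + 1 → ∃ p : ℕ → V, p 0 = v ∧ Set.InjOn p (Set.Iic (j + 1)) ∧
      (∀ i ≤ j, G.Adj (p i) (p (i + 1))) ∧
      p (j + 1) ∈ (if Even j then X else Y) := by
  intro j
  induction j with
  | zero =>
    intro _
    obtain ⟨x, hx⟩ := hX
    have hne : v ≠ x := (hadj x hx).ne
    refine ⟨fun i => if i = 0 then v else x, by simp, ?_, ?_, by simpa using hx⟩
    · intro a ha b hb hab
      simp only [Set.mem_Iic] at ha hb
      have ha' : a = 0 ∨ a = 1 := by omega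
      have hb' : b = 0 ∨ b = 1 := by omega
      rcases ha' with rfl | rfl <;> rcases hb' with rfl | rfl <;> simp_all
    · intro i hi
      have : i = 0 := by omega
      subst this
      simpa using hadj x hx
  | succ j ih =>
    intro hj
    obtain ⟨p, hp0, hinj, hp, hlast⟩ := ih (by omega)
    -- a fresh neighbour
    have key : ∃ z ∈ (if Even (j + 1) then X else Y), G.Adj (p (j + 1)) z ∧
        z ∉ (Finset.Icc 1 j).image p := by
      have hcard : ((Finset.Icc 1 j).image p).card ≤ s :=
        Finset.card_image_le.trans (by simp; omega)
      by_cases he : Even j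
      · have he' : ¬ Even (j + 1) := by simpa [Nat.even_add_one] using he
        rw [if_pos he] at hlast
        rw [if_neg he']
        obtain ⟨z, hz, hz'⟩ := Finset.exists_mem_notMem_of_card_lt_card
          (lt_of_le_of_lt hcard (h1 _ hlast))
        rw [Finset.mem_filter] at hz
        exact ⟨z, hz.1, hz.2, hz'⟩
      · have he' : Even (j + 1) := by simpa [Nat.even_add_one] using he
        rw [if_neg he] at hlast
        rw [if_pos he']
        obtain ⟨z, hz, hz'⟩ := Finset.exists_mem_notMem_of_card_lt_card
          (lt_of_le_of_lt hcard (h2 _ hlast))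
        rw [Finset.mem_filter] at hz
        exact ⟨z, hz.1, hz.2.symm, hz'⟩
    obtain ⟨z, hz, hza, hzn⟩ := key
    have hzv : z ≠ v := by
      rintro rfl
      split_ifs at hz <;> contradiction
    have hfresh : ∀ i ≤ j + 1, p i ≠ z := by
      intro i hi h
      rcases Nat.eq_zero_or_pos i with rfl | hpos
      · exact hzv (h.symm.trans hp0)
      rcases Nat.lt_or_ge j i with hlt | hle
      · have : i = j + 1 := by omega
        subst this
        exact hza.ne h
      · exact hzn (Finset.mem_image.2 ⟨i, Finset.mem_Icc.2 ⟨hpos, hle⟩, h⟩)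
    refine ⟨fun i => if i = j + 2 then z else p i, by simpa using hp0, ?_, ?_, by simpa using hz⟩
    · intro a ha b hb hab
      simp only [Set.mem_Iic] at ha hb
      simp only at hab
      split_ifs at hab with h3 h4 h4
      · omega
      · exact absurd hab.symm (hfresh b (by omega))
      · exact absurd hab (hfresh a (by omega))
      · exact hinj (by simp only [Set.mem_Iic]; omega) (by simp only [Set.mem_Iic]; omega) hab
    · intro i hi
      rcases Nat.lt_or_ge j i with hlt | hle
      · have : i = j + 1 := by omega
        subst this
        simpa using hza
      · have h3 : i ≠ j + 2 := by omega
        have h4 : i + 1 ≠ j + 2 := by omega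
        simp only [if_neg h3, if_neg h4]
        exact hp i hle

theorem containsSub_cycle_of_path {V : Type*} (G : SimpleGraph V) (n : ℕ) (hn : 3 ≤ n)
    (p : ℕ → V) (hinj : Set.InjOn p (Set.Iio n)) (hp : ∀ i, i + 1 < n → G.Adj (p i) (p (i + 1)))
    (hc : G.Adj (p (n - 1)) (p 0)) : G.ContainsSub (cycleGraph n) := by
  refine ⟨fun i => p i, ?_, ?_⟩
  · intro a b hab
    exact Fin.ext (hinj a.2 b.2 hab)
  · have step : ∀ a b : Fin n, (a - b).val = 1 → G.Adj (p a) (p b) := by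
      intro a b hab
      rw [Fin.sub_def] at hab
      simp only at hab
      have ha := a.2
      have hb := b.2
      rcases Nat.lt_or_ge (n - b.val + a.val) n with hlt | hge
      · rw [Nat.mod_eq_of_lt hlt] at hab
        have h0 : a.val = 0 := by omega
        have h1 : b.val = n - 1 := by omega
        rw [h0, h1]; exact hc.symm
      · rw [Nat.mod_eq_sub_mod hge, Nat.mod_eq_of_lt (by omega)] at hab
        have : a.val = b.val + 1 := by omega
        rw [this]
        exact (hp _ (by omega)).symm
    intro a b hab
    rw [cycleGraph_adj'] at hab
    rcases hab with h | h
    · exact step a b h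
    · exact (step b a h).symm

/-- In a `C_{2k}`-free graph, few edges leave the neighbourhood of a vertex. -/
theorem sum_degree_nbhd_le {V : Type*} [DecidableEq V] (k : ℕ) (hk : 3 ≤ k)
    (G : SimpleGraph V) [DecidableRel G.Adj]
    (hfree : ¬ G.ContainsSub (cycleGraph (2 * k))) (W : Finset V) (v : V) (hv : v ∈ W) :
    ∑ u ∈ W.filter (fun u => G.Adj v u), (W.filter (fun w => G.Adj u w)).card ≤
      (2 * k - 2) * (W.filter (fun u => G.Adj v u)).card + (2 * k - 3) * W.card := by
  by_contra hcon
  push Not at hcon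
  apply hfree
  set X := W.filter (fun u => G.Adj v u) with hX
  set Y := W.erase v with hY
  have hYc : Y.card + 1 = W.card := Finset.card_erase_add_one hv
  have hsum : ∑ u ∈ X, (W.filter (fun w => G.Adj u w)).card ≤
      ∑ u ∈ X, (Y.filter (fun w => G.Adj u w)).card + X.card := by
    rw [Finset.card_eq_sum_ones X, ← Finset.sum_add_distrib]
    apply Finset.sum_le_sum
    intro u _
    rw [hY, Finset.filter_erase]
    have := Finset.pred_card_le_card_erase (s := W.filter (fun w => G.Adj u w)) (a := v)
    omega
  obtain ⟨X', hX', Y', hY', hne, h1, h2⟩ := exists_minDegree_sub G.Adj (2 * k - 3)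
    (X.card + Y.card) X Y rfl (by
      have e : 2 * k - 2 = (2 * k - 3) + 1 := by omega
      rw [e, ← hYc] at hcon
      nlinarith)
  have hadj : ∀ x ∈ X', G.Adj v x := fun x hx => (Finset.mem_filter.1 (hX' hx)).2
  obtain ⟨p, hp0, hinj, hp, hl⟩ := exists_greedy_path G (2 * k - 3) v X' Y' hne
    (fun h => (hadj v h).ne rfl) (fun h => by simpa [hY] using hY' h) hadj h1 h2 (2 * k - 2)
    (by omega)
  have hev : Even (2 * k - 2) := ⟨k - 1, by omega⟩
  rw [if_pos hev] at hl
  apply containsSub_cycle_of_path G (2 * k) (by omega) p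
  · exact hinj.mono (fun i hi => by simp only [Set.mem_Iio, Set.mem_Iic] at *; omega)
  · intro i hi
    exact hp i (by omega)
  · have : 2 * k - 1 = 2 * k - 2 + 1 := by omega
    rw [this, hp0]
    exact (hadj _ hl).symm

/-- Upper bound for the number of edges in a vertex set spanned densely. -/
theorem dense_bound {V : Type*} [DecidableEq V] (k : ℕ) (hk : 3 ≤ k)
    (G : SimpleGraph V) [DecidableRel G.Adj]
    (hfree : ¬ G.ContainsSub (cycleGraph (2 * k))) (W : Finset V) :
    (∑ u ∈ W, (W.filter (fun w => G.Adj u w)).card) ^ 2 ≤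
      W.card * ((2 * k - 2) * ∑ u ∈ W, (W.filter (fun w => G.Adj u w)).card
        + (2 * k - 3) * W.card * W.card) := by
  set d : V → ℕ := fun u => (W.filter (fun w => G.Adj u w)).card with hd
  have h1 : ∑ v ∈ W, ∑ u ∈ W.filter (fun u => G.Adj v u), d u = ∑ u ∈ W, d u ^ 2 := by
    simp_rw [Finset.sum_filter]
    rw [Finset.sum_comm]
    apply Finset.sum_congr rfl
    intro u _
    rw [← Finset.sum_filter, Finset.sum_const, smul_eq_mul, sq]
    congr 1
    simp only [hd]
    congr 1
    ext w
    simp [G.adj_comm]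
  have h2 : ∑ v ∈ W, ∑ u ∈ W.filter (fun u => G.Adj v u), d u ≤
      ∑ v ∈ W, ((2 * k - 2) * d v + (2 * k - 3) * W.card) :=
    Finset.sum_le_sum (fun v hv => sum_degree_nbhd_le k hk G hfree W v hv)
  rw [h1, Finset.sum_add_distrib, ← Finset.mul_sum, Finset.sum_const, smul_eq_mul] at h2
  have h3 : (∑ u ∈ W, d u) ^ 2 ≤ W.card * ∑ u ∈ W, d u ^ 2 := sq_sum_le_card_mul_sum_sq
  refine h3.trans (Nat.mul_le_mul_left _ (h2.trans (le_of_eq ?_)))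
  ring

/-- A strong matching clique in a `C_{2k}`-free graph is small. -/
theorem matching_bound {V : Type*} [DecidableEq V] (k : ℕ) (hk : 3 ≤ k)
    (G : SimpleGraph V) [DecidableRel G.Adj]
    (hfree : ¬ G.ContainsSub (cycleGraph (2 * k))) (M : Finset (Sym2 V))
    (hM : G.IsStrongClique M)
    (hdis : ∀ e ∈ M, ∀ f ∈ M, ∀ x, x ∈ e → x ∈ f → e = f) :
    M.card ≤ 20 * k - 28 := by
  set W : Finset V := M.biUnion Sym2.toFinset with hW
  have hWc : W.card ≤ 2 * M.card := by
    rw [mul_comm]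
    apply Finset.card_biUnion_le_card_mul
    intro e he
    rw [Sym2.card_toFinset]
    split_ifs <;> omega
  have hS : M.card * M.card ≤ ∑ u ∈ W, (W.filter (fun w => G.Adj u w)).card := by
    have hex : ∀ q : Sym2 V × Sym2 V, q ∈ M ×ˢ M →
        ∃ r : V × V, r.1 ∈ q.1 ∧ r.2 ∈ q.2 ∧ G.Adj r.1 r.2 := by
      rintro ⟨e, f⟩ hq
      rw [Finset.mem_product] at hq
      obtain ⟨he, hf⟩ := hq
      simp only at he hf
      by_cases hef : e = f
      · subst hef
        have hee := hM.1 he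
        induction e using Sym2.ind with
        | _ a b => exact ⟨(a, b), by simp, by simp, by simpa using hee⟩
      · obtain ⟨x, hx, y, hy, h⟩ := hM.2 e he f hf hef
        rcases h with rfl | h
        · exact absurd (hdis e he f hf x hx hy) hef
        · exact ⟨(x, y), hx, hy, h⟩
    have hne : Nonempty V ∨ M = ∅ := by
      rcases M.eq_empty_or_nonempty with h | ⟨e, _⟩
      · exact Or.inr h
      · exact Or.inl (e.ind (fun a _ => ⟨a⟩))
    rcases hne with hne | hne
    swap
    · rw [hne]; simp
    choose! g hg using hex
    rw [← Finset.card_product, ← Finset.card_sigma]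
    apply Finset.card_le_card_of_injOn (fun q => (⟨(g q).1, (g q).2⟩ : Σ _ : V, V))
    · intro q hq
      obtain ⟨h1, h2, h3⟩ := hg q hq
      have hq' := Finset.mem_product.1 hq
      have w1 : (g q).1 ∈ W := Finset.mem_biUnion.2 ⟨_, hq'.1, Sym2.mem_toFinset.2 h1⟩
      have w2 : (g q).2 ∈ W := Finset.mem_biUnion.2 ⟨_, hq'.2, Sym2.mem_toFinset.2 h2⟩
      simp [w1, w2, h3]
    · intro q hq r hr hqr
      obtain ⟨h1, h2, _⟩ := hg q hq
      obtain ⟨h3, h4, _⟩ := hg r hr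
      have hq' := Finset.mem_product.1 hq
      have hr' := Finset.mem_product.1 hr
      simp only [Sigma.mk.injEq, heq_eq_eq] at hqr
      rw [hqr.1] at h1
      rw [hqr.2] at h2
      exact Prod.ext (hdis _ hq'.1 _ hr'.1 _ h1 h3) (hdis _ hq'.2 _ hr'.2 _ h2 h4)
  have hD := dense_bound k hk G hfree W
  set S := ∑ u ∈ W, (W.filter (fun w => G.Adj u w)).card
  clear_value S
  generalize W.card = n at *
  generalize M.card = m at *
  obtain ⟨t, rfl⟩ : ∃ t, k = t + 3 := ⟨k - 3, by omega⟩
  have e2 : 2 * (t + 3) - 2 = 2 * t + 4 := by omega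
  have e3 : 2 * (t + 3) - 3 = 2 * t + 3 := by omega
  rw [e2, e3] at hD
  by_contra hcon
  have hm : 20 * t + 33 ≤ m := by omega
  have hD2 : S ^ 2 ≤ (2 * m) * ((2 * t + 4) * S + (2 * t + 3) * (2 * m) * (2 * m)) :=
    hD.trans (by gcongr)
  obtain ⟨r, rfl⟩ : ∃ r, S = m * m + r := ⟨S - m * m, by omega⟩
  have p1 : m * (20 * t + 33) ≤ m * m := Nat.mul_le_mul_left _ hm
  have p2 : m * m * (m * (20 * t + 33)) ≤ m * m * (m * m) := Nat.mul_le_mul_left _ p1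
  have p3 : r * (m * (20 * t + 33)) ≤ r * (m * m) := Nat.mul_le_mul_left _ p1
  have m0 : 0 < m := by omega
  have p4 : 0 < m * m * m := by positivity
  nlinarith [Nat.zero_le (r * m), Nat.zero_le (r * m * t), Nat.zero_le (m * m * m * t),
    Nat.zero_le (r * r)]

theorem strongClique_card_le {V : Type*} [Fintype V] [DecidableEq V]
    (G : SimpleGraph V) [DecidableRel G.Adj] (F : Finset (Sym2 V)) (hF : G.IsStrongClique F) :
    ∃ M ⊆ F, (∀ e ∈ M, ∀ f ∈ M, ∀ x, x ∈ e → x ∈ f → e = f) ∧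
      F.card ≤ M.card * (2 * G.maxDegree - 1) := by
  classical
  set P := F.powerset.filter (fun M => ∀ e ∈ M, ∀ f ∈ M, ∀ x, x ∈ e → x ∈ f → e = f) with hP
  have hPne : P.Nonempty := ⟨∅, by simp [hP]⟩
  obtain ⟨M, hMP, hmax⟩ := Finset.exists_max_image P Finset.card hPne
  rw [hP, Finset.mem_filter, Finset.mem_powerset] at hMP
  obtain ⟨hMF, hdis⟩ := hMP
  refine ⟨M, hMF, hdis, ?_⟩
  have hcover : F ⊆ M.biUnion (fun e => F.filter (fun f => ∃ x, x ∈ e ∧ x ∈ f)) := by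
    intro f hf
    simp only [Finset.mem_biUnion, Finset.mem_filter]
    by_contra hcon
    push Not at hcon
    have hno : ∀ e ∈ M, ∀ x, x ∈ e → x ∉ f := fun e he => hcon e he hf
    have hfM : f ∉ M := by
      intro h
      induction f using Sym2.ind with
      | _ a b => exact hno _ h a (by simp) (by simp)
    have := hmax (insert f M) (by
      rw [hP, Finset.mem_filter, Finset.mem_powerset]
      refine ⟨Finset.insert_subset hf hMF, ?_⟩
      intro e he g hg x hxe hxg
      rw [Finset.mem_insert] at he hg
      rcases he with rfl | he <;> rcases hg with rfl | hg
      · rfl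
      · exact absurd hxe (hno g hg x hxg)
      · exact absurd hxg (hno e he x hxe)
      · exact hdis e he g hg x hxe hxg)
    rw [Finset.card_insert_of_notMem hfM] at this
    omega
  refine (Finset.card_le_card hcover).trans (Finset.card_biUnion_le_card_mul _ _ _ ?_)
  intro e he
  have heG := hF.1 (hMF he)
  induction e using Sym2.ind with
  | _ a b =>
    have hsub : F.filter (fun f => ∃ x, x ∈ s(a, b) ∧ x ∈ f) ⊆
        G.incidenceFinset a ∪ G.incidenceFinset b := by
      intro f hf
      rw [Finset.mem_filter] at hf
      obtain ⟨hfF, x, hx, hxf⟩ := hf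
      have hfG := hF.1 hfF
      rw [Finset.mem_union, mem_incidenceFinset, mem_incidenceFinset]
      rcases Sym2.mem_iff.1 hx with rfl | rfl
      · exact Or.inl ⟨hfG, hxf⟩
      · exact Or.inr ⟨hfG, hxf⟩
    have hint : 0 < (G.incidenceFinset a ∩ G.incidenceFinset b).card := by
      apply Finset.card_pos.2
      refine ⟨s(a, b), ?_⟩
      rw [Finset.mem_inter, mem_incidenceFinset, mem_incidenceFinset]
      exact ⟨⟨heG, by simp⟩, ⟨heG, by simp⟩⟩
    have hu := Finset.card_union_add_card_inter (G.incidenceFinset a) (G.incidenceFinset b)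
    rw [card_incidenceFinset_eq_degree, card_incidenceFinset_eq_degree] at hu
    have ha := G.degree_le_maxDegree a
    have hb := G.degree_le_maxDegree b
    have := Finset.card_le_card hsub
    omega

/-- The explicit bound from the proof of Theorem 1.5(2): if `k ≥ 3` and `G` is
`C_{2k}`-free with maximum degree `Δ ≥ 3`, then `ω₂'(G) ≤ (5k² + 14k)(Δ - 1)`. -/
theorem strongCliqueNumber_le_of_evenCycleFree' {V : Type*} [Fintype V] [DecidableEq V]
    (k : ℕ) (hk : 3 ≤ k) (G : SimpleGraph V) [DecidableRel G.Adj]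
    (Δ : ℕ) (hΔ : G.maxDegree = Δ) (hΔ' : 3 ≤ Δ)
    (hfree : ¬ G.ContainsSub (cycleGraph (2 * k))) :
    G.strongCliqueNumber ≤ (5 * k ^ 2 + 14 * k) * (Δ - 1) := by
  apply csSup_le
  · exact ⟨0, ∅, ⟨by simp, by simp⟩, rfl⟩
  · rintro n ⟨F, hF, rfl⟩
    obtain ⟨M, hMF, hdis, hcard⟩ := strongClique_card_le G F hF
    have hMc : G.IsStrongClique M :=
      ⟨fun e he => hF.1 (hMF he), fun e he f hf => hF.2 e (hMF he) f (hMF hf)⟩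
    have hm := matching_bound k hk G hfree M hMc hdis
    rw [hΔ] at hcard
    obtain ⟨D, rfl⟩ : ∃ D, Δ = D + 3 := ⟨Δ - 3, by omega⟩
    have e1 : 2 * (D + 3) - 1 = 2 * D + 5 := by omega
    have e2 : D + 3 - 1 = D + 2 := by omega
    rw [e1] at hcard
    rw [e2]
    have h5 : 5 * M.card ≤ 2 * (5 * k ^ 2 + 14 * k) := by
      have : 5 * M.card + 140 ≤ 100 * k := by omega
      zify at this ⊢
      nlinarith [sq_nonneg ((5 : ℤ) * k - 18)]
    have h6 : 2 * F.card ≤ 2 * ((5 * k ^ 2 + 14 * k) * (D + 2)) := by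
      calc 2 * F.card ≤ 2 * (M.card * (2 * D + 5)) := by omega
        _ ≤ (5 * M.card) * (D + 2) := by nlinarith [Nat.zero_le (M.card * D)]
        _ ≤ (2 * (5 * k ^ 2 + 14 * k)) * (D + 2) := Nat.mul_le_mul_right _ h5
        _ = _ := by ring
    omega
end
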